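/- Let (A,β) be a braided Hopf algebra over a field k. On the tensor product coalgebra A ⊗ A, define bilinear forms [β]₂₁(a⊗b, a'⊗b') = ε(a')ε(b)β(a,b'), δ(a⊗b, a'⊗b') = β(a,a')β⁻¹(b',b), and [β]⁻¹(a⊗b, a'⊗b') = ε(a)ε(b')β⁻¹(a',b), where β⁻¹ is the convolution inverse of β. Then the convolution product [β]₂₁ * δ * [β]⁻¹ (convolution taken with respect to the tensor coalgebra structure on A ⊗ A) equals the form γ given by γ(a ⊗ b, a' ⊗ b') = Σ β(a, a₁'b₁') β⁻¹(a₂'b₂', b). -/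

import Mathlib

/-!
STATEMENT 16: Let (A,β) be a braided Hopf algebra over a field k.  On the tensor product
coalgebra A ⊗ A define [β]₂₁(a⊗b, a'⊗b') = ε(a')ε(b)β(a,b'),
δ(a⊗b, a'⊗b') = β(a,a')β⁻¹(b',b) and [β]⁻¹(a⊗b, a'⊗b') = ε(a)ε(b')β⁻¹(a',b).
Then [β]₂₁ * δ * [β]⁻¹ = γ, where γ(a⊗b, a'⊗b') = Σ β(a, a₁'b₁') β⁻¹(a₂'b₂', b).
-/

open TensorProduct Coalgebra LinearMap

noncomputable section

variable {k : Type} [Field k]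

/-- Convolution product of linear maps from a coalgebra `C` to an algebra `M`:
`(f * g)(c) = Σ f(c₁) g(c₂)`. -/
def conv {C M : Type} [AddCommGroup C] [Module k C] [Coalgebra k C]
    [Ring M] [Algebra k M] (f g : C →ₗ[k] M) : C →ₗ[k] M :=
  (LinearMap.mul' k M) ∘ₗ (TensorProduct.map f g) ∘ₗ Coalgebra.comul

/-- `Σ g(c₁) • f(c₂)`. -/
def convL {C M : Type} [AddCommGroup C] [Module k C] [Coalgebra k C]
    [AddCommGroup M] [Module k M] (g : C →ₗ[k] k) (f : C →ₗ[k] M) : C →ₗ[k] M :=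
  (TensorProduct.lid k M).toLinearMap ∘ₗ (TensorProduct.map g f) ∘ₗ Coalgebra.comul

/-- `Σ g(c₂) • f(c₁)`. -/
def convR {C M : Type} [AddCommGroup C] [Module k C] [Coalgebra k C]
    [AddCommGroup M] [Module k M] (f : C →ₗ[k] M) (g : C →ₗ[k] k) : C →ₗ[k] M :=
  (TensorProduct.rid k M).toLinearMap ∘ₗ (TensorProduct.map f g) ∘ₗ Coalgebra.comul

/-- Convolution invertibility of a bilinear form. -/
def IsConvInvertible {C : Type} [AddCommGroup C] [Module k C] [Coalgebra k C]
    (τ : C →ₗ[k] k) : Prop :=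
  ∃ τi : C →ₗ[k] k, conv τ τi = Coalgebra.counit ∧ conv τi τ = Coalgebra.counit

/-- A skew pairing on the ordered pair `(A, U)`. -/
structure IsSkewPairing {A U : Type} [Ring A] [Ring U] [HopfAlgebra k A] [HopfAlgebra k U]
    (τ : A ⊗[k] U →ₗ[k] k) : Prop where
  mul_left : ∀ (b c : A) (u : U),
    τ ((b * c) ⊗ₜ u) = conv (τ ∘ₗ TensorProduct.mk k A U b) (τ ∘ₗ TensorProduct.mk k A U c) u
  mul_right : ∀ (b : A) (u v : U),
    τ (b ⊗ₜ (u * v)) =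
      conv (τ ∘ₗ (TensorProduct.mk k A U).flip v) (τ ∘ₗ (TensorProduct.mk k A U).flip u) b
  one_left : ∀ u : U, τ (1 ⊗ₜ u) = Coalgebra.counit u
  one_right : ∀ a : A, τ (a ⊗ₜ 1) = Coalgebra.counit a

/-- A braiding on a Hopf algebra `A`. -/
structure IsBraiding {A : Type} [Ring A] [HopfAlgebra k A] (β : A ⊗[k] A →ₗ[k] k) : Prop where
  skew : IsSkewPairing β
  invertible : IsConvInvertible β
  compat : ∀ a b : A,
    convR ((LinearMap.mul' k A) ∘ₗ (TensorProduct.comm k A A).toLinearMap) β (a ⊗ₜ b)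
      = convL β (LinearMap.mul' k A) (a ⊗ₜ b)

variable {A : Type} [Ring A] [HopfAlgebra k A]

/-- `[β]₂₁(a⊗b, a'⊗b') = ε(a')ε(b)β(a,b')`. -/
def bracketTwentyOne (β : A ⊗[k] A →ₗ[k] k) :
    (A ⊗[k] A) ⊗[k] (A ⊗[k] A) →ₗ[k] k :=
  β ∘ₗ
    TensorProduct.map
      ((TensorProduct.rid k A).toLinearMap ∘ₗ
        TensorProduct.map LinearMap.id (Coalgebra.counit (R := k)))
      ((TensorProduct.lid k A).toLinearMap ∘ₗ
        TensorProduct.map (Coalgebra.counit (R := k)) LinearMap.id) ∘ₗ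
    (TensorProduct.tensorTensorTensorComm k A A A A).toLinearMap

/-- `δ(a⊗b, a'⊗b') = β(a,a') β⁻¹(b',b)`, i.e. the braiding `(β, β₂₁⁻¹)` on `A ⊗ A`. -/
def deltaForm (β βi : A ⊗[k] A →ₗ[k] k) :
    (A ⊗[k] A) ⊗[k] (A ⊗[k] A) →ₗ[k] k :=
  (LinearMap.mul' k k) ∘ₗ
    TensorProduct.map β (βi ∘ₗ (TensorProduct.comm k A A).toLinearMap) ∘ₗ
    (TensorProduct.tensorTensorTensorComm k A A A A).toLinearMap

/-- `[β]⁻¹(a⊗b, a'⊗b') = ε(a)ε(b')β⁻¹(a',b)`. -/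
def bracketInv (βi : A ⊗[k] A →ₗ[k] k) :
    (A ⊗[k] A) ⊗[k] (A ⊗[k] A) →ₗ[k] k :=
  βi ∘ₗ
    TensorProduct.map
      ((TensorProduct.lid k A).toLinearMap ∘ₗ
        TensorProduct.map (Coalgebra.counit (R := k)) LinearMap.id)
      ((TensorProduct.rid k A).toLinearMap ∘ₗ
        TensorProduct.map LinearMap.id (Coalgebra.counit (R := k))) ∘ₗ
    (TensorProduct.tensorTensorTensorComm k A A A A).toLinearMap

/-- `γ(a⊗b, a'⊗b') = Σ β(a, a₁'b₁') β⁻¹(a₂'b₂', b)`. -/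
def gammaForm (β βi : A ⊗[k] A →ₗ[k] k) :
    (A ⊗[k] A) ⊗[k] (A ⊗[k] A) →ₗ[k] k :=
  (LinearMap.mul' k k) ∘ₗ
    TensorProduct.map β (βi ∘ₗ (TensorProduct.comm k A A).toLinearMap) ∘ₗ
    (TensorProduct.tensorTensorTensorComm k A A A A).toLinearMap ∘ₗ
    LinearMap.lTensor (A ⊗[k] A)
      (TensorProduct.map (LinearMap.mul' k A) (LinearMap.mul' k A) ∘ₗ Coalgebra.comul)

section Convolution

variable {C D M : Type} [AddCommGroup C] [Module k C] [Coalgebra k C]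
  [AddCommGroup D] [Module k D] [Coalgebra k D] [Ring M] [Algebra k M]

theorem conv_eq_sum (f g : C →ₗ[k] M) {ι : Type} {c : C} (r : Coalgebra.Repr k c ι) :
    conv f g c = ∑ i ∈ r.index, f (r.left i) * g (r.right i) :=
  r.convMul_apply (WithConv.toConv f) (WithConv.toConv g)

theorem conv_tmul (f g : C ⊗[k] D →ₗ[k] M) {ι κ : Type} {c : C} {d : D}
    (r : Coalgebra.Repr k c ι) (s : Coalgebra.Repr k d κ) :
    conv f g (c ⊗ₜ d) = ∑ i ∈ r.index, ∑ j ∈ s.index,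
      f (r.left i ⊗ₜ s.left j) * g (r.right i ⊗ₜ s.right j) := by
  simp [conv, TensorProduct.comul_tmul, ← r.eq, ← s.eq, sum_tmul, tmul_sum]
  exact Finset.sum_comm

theorem conv_assoc (f g h : C →ₗ[k] M) : conv (conv f g) h = conv f (conv g h) :=
  congrArg WithConv.ofConv
    (mul_assoc (WithConv.toConv f) (WithConv.toConv g) (WithConv.toConv h))

theorem conv_counit (f : C →ₗ[k] k) : conv f counit = f :=
  congrArg WithConv.ofConv (mul_one (WithConv.toConv f))

theorem counit_conv (f : C →ₗ[k] k) : conv counit f = f :=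
  congrArg WithConv.ofConv (one_mul (WithConv.toConv f))

theorem conv_comp_coalgHom (f g : D →ₗ[k] M) (h : C →ₗc[k] D) :
    conv (f ∘ₗ h.toLinearMap) (g ∘ₗ h.toLinearMap) = conv f g ∘ₗ h.toLinearMap :=
  (LinearMap.convMul_comp_coalgHom_distrib (WithConv.toConv f) (WithConv.toConv g) h).symm

theorem conv_comp_coalgHom_eq_counit {f g : D →ₗ[k] k} (hfg : conv f g = counit)
    (h : C →ₗc[k] D) :
    conv (f ∘ₗ h.toLinearMap) (g ∘ₗ h.toLinearMap) = counit := by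
  rw [conv_comp_coalgHom, hfg, h.counit_comp]

theorem sum_counit_right_smul {ι : Type} {c : C} (r : Coalgebra.Repr k c ι) :
    ∑ i ∈ r.index, counit (R := k) (r.right i) • r.left i = c := by
  simpa only [map_sum, TensorProduct.rid_tmul, one_smul] using
    congrArg (TensorProduct.rid k C) (sum_tmul_counit_eq r)

end Convolution

/-- The inverse of a form that is multiplicative on the left is antimultiplicative on the left. -/
theorem convInv_mul_left {β βi : A ⊗[k] A →ₗ[k] k}
    (hmul : ∀ b c u : A, β ((b * c) ⊗ₜ u) =
      conv (β ∘ₗ TensorProduct.mk k A A b) (β ∘ₗ TensorProduct.mk k A A c) u)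
    (hinv₁ : conv β βi = counit) (hinv₂ : conv βi β = counit) (x y u : A) :
    βi ((x * y) ⊗ₜ u) =
      conv (βi ∘ₗ TensorProduct.mk k A A y) (βi ∘ₗ TensorProduct.mk k A A x) u := by
  let m : (A ⊗[k] A) ⊗[k] A →ₗc[k] A ⊗[k] A :=
    Coalgebra.TensorProduct.map (Bialgebra.mulCoalgHom k A) (CoalgHom.id k A)
  let p : (A ⊗[k] A) ⊗[k] A →ₗc[k] A ⊗[k] A :=
    Coalgebra.TensorProduct.map
      (((Coalgebra.TensorProduct.rid k k A : A ⊗[k] k ≃ₗc[k] A) : A ⊗[k] k →ₗc[k] A).comp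
        (Coalgebra.TensorProduct.map (CoalgHom.id k A) (counitCoalgHom k A))) (CoalgHom.id k A)
  let q : (A ⊗[k] A) ⊗[k] A →ₗc[k] A ⊗[k] A :=
    Coalgebra.TensorProduct.map
      (((Coalgebra.TensorProduct.lid k A : k ⊗[k] A ≃ₗc[k] A) : k ⊗[k] A →ₗc[k] A).comp
        (Coalgebra.TensorProduct.map (counitCoalgHom k A) (CoalgHom.id k A))) (CoalgHom.id k A)
  have hm (x y u : A) : m.toLinearMap ((x ⊗ₜ y) ⊗ₜ u) = (x * y) ⊗ₜ u := rfl
  have hp (x y u : A) :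
      p ((x ⊗ₜ y) ⊗ₜ u) = (counit (R := k) y • x) ⊗ₜ u := rfl
  have hq (x y u : A) :
      q ((x ⊗ₜ y) ⊗ₜ u) = (counit (R := k) x • y) ⊗ₜ u := rfl
  have key : β ∘ₗ m.toLinearMap = conv (β ∘ₗ p.toLinearMap) (β ∘ₗ q.toLinearMap) := by
    refine TensorProduct.ext_threefold fun x y u ↦ ?_
    rw [conv_tmul _ _ ((ℛ k x).tmul (ℛ k y)) (ℛ k u), LinearMap.comp_apply, hm, hmul,
      conv_eq_sum _ _ (ℛ k u), Finset.sum_comm]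
    refine Finset.sum_congr rfl fun i _ ↦ ?_
    conv_lhs => rw [← sum_counit_right_smul (ℛ k x), ← sum_counit_smul (ℛ k y)]
    simp [Coalgebra.Repr.tmul, Finset.sum_product, hp, hq, Finset.sum_mul_sum,
      ← smul_tmul']
    refine Finset.sum_congr rfl fun _ _ ↦ Finset.sum_congr rfl fun _ _ ↦ ?_
    ring
  have hinv : βi ∘ₗ m.toLinearMap = conv (βi ∘ₗ q.toLinearMap) (βi ∘ₗ p.toLinearMap) := by
    have hright : conv (β ∘ₗ m.toLinearMap)
        (conv (βi ∘ₗ q.toLinearMap) (βi ∘ₗ p.toLinearMap)) = counit := by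
      rw [key, conv_assoc, ← conv_assoc (β ∘ₗ q.toLinearMap),
        conv_comp_coalgHom_eq_counit hinv₁, counit_conv, conv_comp_coalgHom_eq_counit hinv₁]
    rw [← conv_counit (βi ∘ₗ m.toLinearMap), ← hright, ← conv_assoc,
      conv_comp_coalgHom_eq_counit hinv₂, counit_conv]
  have h := LinearMap.congr_fun hinv ((x ⊗ₜ y) ⊗ₜ u)
  rw [LinearMap.comp_apply, hm] at h
  rw [h, conv_tmul _ _ ((ℛ k x).tmul (ℛ k y)) (ℛ k u), conv_eq_sum _ _ (ℛ k u), Finset.sum_comm]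
  refine Finset.sum_congr rfl fun i _ ↦ ?_
  conv_rhs => rw [← sum_counit_smul (ℛ k x), ← sum_counit_right_smul (ℛ k y)]
  simp [Coalgebra.Repr.tmul, Finset.sum_product_right, hp, hq, Finset.sum_mul_sum,
    ← smul_tmul']
  refine Finset.sum_congr rfl fun _ _ ↦ Finset.sum_congr rfl fun _ _ ↦ ?_
  ring

theorem bracketTwentyOne_tmul (β : A ⊗[k] A →ₗ[k] k) (a b a' b' : A) :
    bracketTwentyOne β ((a ⊗ₜ b) ⊗ₜ (a' ⊗ₜ b')) =
      counit (R := k) b * (counit (R := k) a' * β (a ⊗ₜ b')) := by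
  simp [bracketTwentyOne, ← smul_tmul']

theorem deltaForm_tmul (β βi : A ⊗[k] A →ₗ[k] k) (a b a' b' : A) :
    deltaForm β βi ((a ⊗ₜ b) ⊗ₜ (a' ⊗ₜ b')) = β (a ⊗ₜ a') * βi (b' ⊗ₜ b) := by
  simp [deltaForm]

theorem bracketInv_tmul (βi : A ⊗[k] A →ₗ[k] k) (a b a' b' : A) :
    bracketInv βi ((a ⊗ₜ b) ⊗ₜ (a' ⊗ₜ b')) =
      counit (R := k) a * (counit (R := k) b' * βi (a' ⊗ₜ b)) := by
  simp [bracketInv, ← smul_tmul']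
  ring

theorem conv_bracketInv (f : (A ⊗[k] A) ⊗[k] (A ⊗[k] A) →ₗ[k] k) (βi : A ⊗[k] A →ₗ[k] k)
    (a b a' b' : A) :
    conv f (bracketInv βi) ((a ⊗ₜ b) ⊗ₜ (a' ⊗ₜ b')) =
      ∑ j ∈ (ℛ k b).index, ∑ i' ∈ (ℛ k a').index,
        f ((a ⊗ₜ (ℛ k b).left j) ⊗ₜ ((ℛ k a').left i' ⊗ₜ b')) *
          βi ((ℛ k a').right i' ⊗ₜ (ℛ k b).right j) := by
  rw [conv_tmul _ _ ((ℛ k a).tmul (ℛ k b)) ((ℛ k a').tmul (ℛ k b'))]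
  simp only [Coalgebra.Repr.tmul, Finset.sum_product_right]
  refine Finset.sum_congr rfl fun j _ ↦ ?_
  simp only [Finset.sum_comm (s := (ℛ k b').index)]
  rw [Finset.sum_comm]
  refine Finset.sum_congr rfl fun i' _ ↦ ?_
  conv_rhs => rw [← sum_counit_right_smul (ℛ k a), ← sum_counit_right_smul (ℛ k b')]
  simp only [bracketInv_tmul, sum_tmul, tmul_sum, smul_tmul, tmul_smul, map_sum, map_smul,
    smul_eq_mul, Finset.sum_mul]
  simp only [Finset.mul_sum, Finset.sum_mul]
  rw [Finset.sum_comm]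
  refine Finset.sum_congr rfl fun _ _ ↦ Finset.sum_congr rfl fun _ _ ↦ ?_
  ring

theorem conv_bracketTwentyOne (f : (A ⊗[k] A) ⊗[k] (A ⊗[k] A) →ₗ[k] k)
    (β : A ⊗[k] A →ₗ[k] k) (a b a' b' : A) :
    conv (bracketTwentyOne β) f ((a ⊗ₜ b) ⊗ₜ (a' ⊗ₜ b')) =
      ∑ i ∈ (ℛ k a).index, ∑ j' ∈ (ℛ k b').index,
        β ((ℛ k a).left i ⊗ₜ (ℛ k b').left j') *
          f (((ℛ k a).right i ⊗ₜ b) ⊗ₜ (a' ⊗ₜ (ℛ k b').right j')) := by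
  rw [conv_tmul _ _ ((ℛ k a).tmul (ℛ k b)) ((ℛ k a').tmul (ℛ k b'))]
  simp only [Coalgebra.Repr.tmul, Finset.sum_product]
  refine Finset.sum_congr rfl fun i _ ↦ ?_
  simp only [Finset.sum_comm (t := (ℛ k b').index)]
  refine Finset.sum_congr rfl fun j' _ ↦ ?_
  conv_rhs => rw [← sum_counit_smul (ℛ k b), ← sum_counit_smul (ℛ k a')]
  simp only [bracketTwentyOne_tmul, sum_tmul, tmul_sum, smul_tmul, tmul_smul, map_sum, map_smul,
    smul_eq_mul, Finset.mul_sum]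
  rw [Finset.sum_comm]
  refine Finset.sum_congr rfl fun _ _ ↦ Finset.sum_congr rfl fun _ _ ↦ ?_
  ring

/-- `[β]₂₁ * δ * [β]⁻¹ = γ`. -/
theorem bracket_conv_eq_gamma (β : A ⊗[k] A →ₗ[k] k) (hβ : IsBraiding β)
    (βi : A ⊗[k] A →ₗ[k] k)
    (hinv₁ : conv β βi = Coalgebra.counit) (hinv₂ : conv βi β = Coalgebra.counit) :
    conv (conv (bracketTwentyOne β) (deltaForm β βi)) (bracketInv βi) = gammaForm β βi := by
  refine TensorProduct.ext_fourfold' fun a b a' b' ↦ ?_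
  have hγ : gammaForm β βi ((a ⊗ₜ b) ⊗ₜ (a' ⊗ₜ b')) =
      ∑ i' ∈ (ℛ k a').index, ∑ j' ∈ (ℛ k b').index,
        β (a ⊗ₜ ((ℛ k a').left i' * (ℛ k b').left j')) *
          βi (((ℛ k a').right i' * (ℛ k b').right j') ⊗ₜ b) := by
    have h := ((ℛ k a').tmul (ℛ k b')).eq
    simp [gammaForm, ← h, Coalgebra.Repr.tmul, Finset.sum_product, tmul_sum]
  rw [hγ, conv_bracketInv, Finset.sum_comm]
  refine Finset.sum_congr rfl fun i' _ ↦ ?_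
  simp only [conv_bracketTwentyOne, deltaForm_tmul, hβ.skew.mul_right,
    convInv_mul_left hβ.skew.mul_left hinv₁ hinv₂, conv_eq_sum _ _ (ℛ k a),
    conv_eq_sum _ _ (ℛ k b), Finset.sum_mul_sum]
  simp only [Finset.sum_mul, Finset.sum_comm (s := (ℛ k b).index), LinearMap.comp_apply,
    LinearMap.flip_apply, TensorProduct.mk_apply]
  rw [Finset.sum_comm]
  refine Finset.sum_congr rfl fun _ _ ↦ Finset.sum_congr rfl fun _ _ ↦
    Finset.sum_congr rfl fun _ _ ↦ ?_
  ring

end
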